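/- arXiv:1001.2774 — 5 statements merged into one kernel-verified Lean document; each statement's English description precedes it below -/
import Mathlib

section
/- Let r ≥ 1, let d_0 be an integer, and let p_0, p_1, …, p_g be an admissible lingering lattice path in ℤ^r with p_0 = (d_0, d_0−1, …, d_0−r+1). Then for every 1 ≤ i ≤ g and every 1 ≤ j ≤ r−1, the number of steps in direction e_j among the first i steps is at most the number of steps in direction e_{j−1} among the first i steps. -/
open scoped Classical

/-- The `i`-th step of the path `p` is the vector `(−1, …, −1)`. -/
def negStep (r : ℕ) (p : ℕ → Fin r → ℤ) (i : ℕ) : Prop :=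
  ∀ k, p i k = p (i - 1) k - 1

/-- The `i`-th step of the path `p` is the standard basis vector `e j`. -/
def eStep (r : ℕ) (p : ℕ → Fin r → ℤ) (i : ℕ) (j : Fin r) : Prop :=
  ∀ k, p i k = p (i - 1) k + if k = j then 1 else 0

/-- The `i`-th step of the path `p` is zero (a lingering step). -/
def lingerStep (r : ℕ) (p : ℕ → Fin r → ℤ) (i : ℕ) : Prop :=
  ∀ k, p i k = p (i - 1) k

/-- `p 0, p 1, …, p g` is a lingering lattice path in `ℤ^r`: each successive difference is
`(−1, …, −1)`, a standard basis vector, or zero. -/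
def IsLLP (r g : ℕ) (p : ℕ → Fin r → ℤ) : Prop :=
  ∀ i ∈ Finset.Icc 1 g, negStep r p i ∨ (∃ j, eStep r p i j) ∨ lingerStep r p i

/-- The open Weyl chamber `C = {y : y 0 > y 1 > ⋯ > y (r−1) > 0}`. -/
def inC (r : ℕ) (y : Fin r → ℤ) : Prop :=
  (∀ j k : Fin r, j < k → y k < y j) ∧ ∀ k, 0 < y k

/-- The path is admissible: every step in a coordinate direction `e j` occurs only when
both `p (i−1)` and `p (i−1) + e j` lie in the open Weyl chamber. -/
def Admissible (r g : ℕ) (p : ℕ → Fin r → ℤ) : Prop :=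
  ∀ i ∈ Finset.Icc 1 g, ∀ j, eStep r p i j → inC r (p (i - 1)) ∧ inC r (p i)

/-- A basis step determines its direction. -/
lemma eStep_direction_unique {r : ℕ} {p : ℕ → Fin r → ℤ} {i : ℕ} {j k : Fin r}
    (hj : eStep r p i j) (hk : eStep r p i k) : j = k := by
  by_contra hne
  have h₁ := hj j
  have h₂ := hk j
  simp only [if_true, if_neg hne] at h₁ h₂
  omega

/-- Along a single step, the difference of two coordinates changes by the difference of the
indicators of the two basis steps. -/
lemma sub_coord_step {r g : ℕ} {p : ℕ → Fin r → ℤ} (hpath : IsLLP r g p) {i : ℕ}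
    (hi : i ∈ Finset.Icc 1 g) {j k : Fin r} (hne : j ≠ k) :
    p i j - p i k = p (i - 1) j - p (i - 1) k +
      ((if eStep r p i j then 1 else 0) - if eStep r p i k then 1 else 0) := by
  by_cases hj : eStep r p i j
  · have hk : ¬ eStep r p i k := fun hk => hne (eStep_direction_unique hj hk)
    have h₁ := hj j
    have h₂ := hj k
    simp only [if_true, if_neg hne.symm] at h₁ h₂
    simp only [if_pos hj, if_neg hk]
    omega
  by_cases hk : eStep r p i k
  · have h₁ := hk j
    have h₂ := hk k
    simp only [if_true, if_neg hne] at h₁ h₂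
    simp only [if_neg hj, if_pos hk]
    omega
  simp only [if_neg hj, if_neg hk]
  rcases hpath i hi with h | ⟨l, h⟩ | h
  · have h₁ := h j
    have h₂ := h k
    omega
  · have h₁ := h j
    have h₂ := h k
    have hjl : j ≠ l := fun e => hj (e ▸ h)
    have hkl : k ≠ l := fun e => hk (e ▸ h)
    simp only [if_neg hjl, if_neg hkl] at h₁ h₂
    omega
  · have h₁ := h j
    have h₂ := h k
    omega

/-- The difference of two coordinates along a lingering lattice path is its initial value plus the
difference of the numbers of steps in the two directions. -/
lemma sub_coord_eq_card_sub_card {r g : ℕ} {p : ℕ → Fin r → ℤ} (hpath : IsLLP r g p)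
    {j k : Fin r} (hne : j ≠ k) {i : ℕ} (hi : i ≤ g) :
    p i j - p i k = p 0 j - p 0 k +
      ((((Finset.Icc 1 i).filter (fun n => eStep r p n j)).card : ℤ) -
        ((Finset.Icc 1 i).filter (fun n => eStep r p n k)).card) := by
  induction i with
  | zero => simp
  | succ i ih =>
    have hstep := sub_coord_step hpath (Finset.mem_Icc.2 ⟨Nat.le_add_left 1 i, hi⟩) hne
    have ih := ih (by omega)
    simp only [Finset.card_filter, Nat.cast_add, Nat.cast_sum, Nat.cast_ite, Nat.cast_one,
      Nat.cast_zero, Finset.sum_Icc_succ_top (Nat.le_add_left 1 i),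
      Nat.add_sub_cancel] at ih hstep ⊢
    linarith

/-- Strictly decreasing coordinates stay strictly decreasing along an admissible path. -/
lemma coord_lt_of_admissible {r g : ℕ} {p : ℕ → Fin r → ℤ} (hpath : IsLLP r g p)
    (hadm : Admissible r g p) {j k : Fin r} (hjk : j < k) (h₀ : p 0 k < p 0 j)
    {i : ℕ} (hi : i ≤ g) : p i k < p i j := by
  induction i with
  | zero => exact h₀
  | succ i ih =>
    have ih := ih (by omega)
    have hmem : i + 1 ∈ Finset.Icc 1 g := Finset.mem_Icc.2 ⟨Nat.le_add_left 1 i, hi⟩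
    rcases hpath _ hmem with h | ⟨l, h⟩ | h
    · have h₁ := h j
      have h₂ := h k
      simp only [Nat.add_sub_cancel] at h₁ h₂
      omega
    · exact (hadm _ hmem l h).2.1 j k hjk
    · have h₁ := h j
      have h₂ := h k
      simp only [Nat.add_sub_cancel] at h₁ h₂
      omega

/-- For an admissible lingering lattice path in `ℤ^r` starting at `(d₀, d₀−1, …, d₀−r+1)`,
among the first `i` steps the number of steps in direction `e j` is at most the number of
steps in direction `e (j−1)`, for every `1 ≤ j ≤ r−1` and every `1 ≤ i ≤ g`. -/
theorem steps_in_direction_monotone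
    (r : ℕ) (hr : 1 ≤ r) (d₀ : ℤ) (g : ℕ)
    (p : ℕ → Fin r → ℤ) (hpath : IsLLP r g p) (hadm : Admissible r g p)
    (hstart : ∀ j : Fin r, p 0 j = d₀ - (j : ℤ)) :
    ∀ i ∈ Finset.Icc 1 g, ∀ j j' : Fin r, (j' : ℕ) + 1 = (j : ℕ) →
      ((Finset.Icc 1 i).filter (fun n => eStep r p n j)).card ≤
        ((Finset.Icc 1 i).filter (fun n => eStep r p n j')).card := by
  intro i hi j j' hj
  have hig := (Finset.mem_Icc.1 hi).2
  have hlt : j' < j := Fin.lt_def.2 (by omega)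
  have h₀ := hstart j
  have h₀' := hstart j'
  have hsub := sub_coord_eq_card_sub_card hpath hlt.ne hig
  have hdec := coord_lt_of_admissible hpath hadm hlt (by omega) hig
  omega
end

section
/- Let r ≥ 1 and let d, d_0 be integers with d_0 ≥ r. Suppose p_0, p_1, …, p_g is an admissible lingering lattice path in ℤ^r with p_0 = (d_0, d_0−1, …, d_0−r+1), lying entirely in the open Weyl chamber C, and having exactly g − d + d_0 steps equal to (−1,−1,…,−1). Then the Brill–Noether number ρ = g − (r+1)(g−d+r) is nonnegative, and moreover d_0 ≤ r + ρ. (This is the combinatorial core of the tropical Brill–Noether nonexistence theorem: a chain of g loops with generic edge lengths has no effective divisor of degree d and rank r when ρ < 0, and none containing (r+ρ+1)·v_0 when ρ ≥ 0.) -/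
open scoped Classical

/-- A point of the open Weyl chamber dominates `(r, r − 1, …, 1)` coordinatewise. -/
theorem inC.sub_le {r : ℕ} {y : Fin r → ℤ} (hy : inC r y) (k : Fin r) :
    (r : ℤ) - (k : ℤ) ≤ y k := by
  suffices h : ∀ m : ℕ, ∀ k : Fin r, r = k + 1 + m → (m : ℤ) + 1 ≤ y k by
    have hk := k.isLt
    have := h (r - (k + 1)) k (by omega)
    omega
  intro m
  induction m with
  | zero =>
    intro k _
    have := hy.2 k
    push_cast
    omega
  | succ m ih =>
    intro k hk
    have hlt := hy.1 k ⟨k + 1, by omega⟩ (Fin.lt_def.2 (by simp))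
    have := ih ⟨k + 1, by omega⟩ (by simp only; omega)
    push_cast
    omega

/-- Along a lingering lattice path the coordinate sum rises by at most one at each step and
drops by `r` at each step `(−1, …, −1)`. -/
theorem IsLLP.sum_le {r g : ℕ} {p : ℕ → Fin r → ℤ} (hpath : IsLLP r g p) (n : ℕ) (hn : n ≤ g) :
    ∑ k, p n k ≤ ∑ k, p 0 k + n -
      ((r : ℤ) + 1) * (((Finset.Icc 1 n).filter (fun i => negStep r p i)).card : ℤ) := by
  induction n with
  | zero => simp
  | succ n ih =>
    have ih := ih (by omega)
    rw [← Finset.insert_Icc_right_eq_Icc_add_one (by omega), Finset.filter_insert]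
    by_cases hs : negStep r p (n + 1)
    · rw [if_pos hs, Finset.card_insert_of_notMem (by simp)]
      have hsum : ∑ k, p (n + 1) k = ∑ k, p n k - r := by
        simp [Finset.sum_congr rfl fun k _ => hs k]
      rw [hsum]
      push_cast
      linarith
    · rw [if_neg hs]
      have hsum : ∑ k, p (n + 1) k ≤ ∑ k, p n k + 1 := by
        rcases hpath (n + 1) (Finset.mem_Icc.2 ⟨by omega, hn⟩) with h | ⟨j, h⟩ | h
        · exact absurd h hs
        · simp [Finset.sum_congr rfl fun k _ => h k, Finset.sum_add_distrib]
        · simp [Finset.sum_congr rfl fun k _ => h k]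
      push_cast
      linarith

/-- (Combinatorial core of the tropical Brill–Noether nonexistence theorem.)
Let `r ≥ 1`, `d, d₀` integers with `d₀ ≥ r`, and let `p 0, …, p g` be an admissible lingering
lattice path in `ℤ^r` starting at `(d₀, d₀−1, …, d₀−r+1)`, lying entirely in the open Weyl
chamber, with exactly `g − d + d₀` steps equal to `(−1, …, −1)`.  Then the Brill–Noether
number `ρ = g − (r+1)(g−d+r)` is nonnegative, and `d₀ ≤ r + ρ`. -/
theorem brill_noether_nonexistence_core
    (r : ℕ) (hr : 1 ≤ r) (d d₀ : ℤ) (hd₀ : (r : ℤ) ≤ d₀) (g : ℕ)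
    (p : ℕ → Fin r → ℤ) (hpath : IsLLP r g p) (hadm : Admissible r g p)
    (hstart : ∀ j : Fin r, p 0 j = d₀ - (j : ℤ))
    (hC : ∀ i ≤ g, inC r (p i))
    (hneg : (((Finset.Icc 1 g).filter (fun i => negStep r p i)).card : ℤ) = (g : ℤ) - d + d₀) :
    0 ≤ (g : ℤ) - ((r : ℤ) + 1) * ((g : ℤ) - d + (r : ℤ)) ∧
      d₀ ≤ (r : ℤ) + ((g : ℤ) - ((r : ℤ) + 1) * ((g : ℤ) - d + (r : ℤ))) := by
  have hup := hpath.sum_le g le_rfl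
  have hlow : ∑ k, p 0 k + r * ((r : ℤ) - d₀) ≤ ∑ k, p g k := by
    calc ∑ k, p 0 k + r * ((r : ℤ) - d₀) = ∑ k : Fin r, ((r : ℤ) - (k : ℤ)) := by
          simp only [hstart, Finset.sum_sub_distrib, Finset.sum_const, Finset.card_univ,
            Fintype.card_fin, nsmul_eq_mul]
          ring
      _ ≤ ∑ k, p g k := Finset.sum_le_sum fun k _ => (hC g le_rfl).sub_le k
  rw [hneg] at hup
  constructor <;> linarith
end

section
/- Let r ≥ 1, m ≥ 0 and ρ ≥ 0 be integers and set g = (r+1)m + ρ. For every subset S of {1, …, g} with |S| = ρ there exists a lingering lattice path p_0, p_1, …, p_g in ℤ^r with p_0 = p_g = (r, r−1, …, 1), with every p_i in the open Weyl chamber C, whose set of lingering steps is exactly S, and which has exactly m steps in each coordinate direction e_j (0 ≤ j ≤ r−1) and exactly m steps equal to (−1,−1,…,−1). (This realizability of any prescribed set of min{ρ, g} lingering steps gives the lower bound dim W^r_d(Γ) ≥ min{ρ, g} in the tropical Brill–Noether dimension theorem.) -/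
open scoped Classical

/-- The lattice path `e 0, e 1, …, e (r−1), (−1, …, −1)`, repeated periodically, after `t` steps. -/
def cyclicPath (r t : ℕ) (j : Fin r) : ℤ :=
  (r : ℤ) - j + if (j : ℕ) < t % (r + 1) then 1 else 0

lemma inC_cyclicPath (r t : ℕ) : inC r (cyclicPath r t) := by
  refine ⟨fun j k hjk => ?_, fun k => ?_⟩
  · have : (j : ℕ) < k := hjk
    unfold cyclicPath
    split_ifs <;> omega
  · have := k.isLt
    unfold cyclicPath
    split_ifs <;> omega

lemma cyclicPath_mul (r m : ℕ) (j : Fin r) : cyclicPath r ((r + 1) * m) j = (r : ℤ) - j := by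
  simp [cyclicPath]

lemma cyclicPath_succ_of_lt {r t : ℕ} (h : t % (r + 1) < r) (k : Fin r) :
    cyclicPath r (t + 1) k = cyclicPath r t k + if (k : ℕ) = t % (r + 1) then 1 else 0 := by
  have h' : (t + 1) % (r + 1) = t % (r + 1) + 1 := by
    rw [Nat.add_mod_eq_ite, Nat.mod_eq_of_lt (show 1 < r + 1 by omega), if_neg (by omega)]
  unfold cyclicPath
  rw [h']
  split_ifs <;> omega

lemma cyclicPath_succ_of_eq {r t : ℕ} (h : t % (r + 1) = r) (k : Fin r) :
    cyclicPath r (t + 1) k = cyclicPath r t k - 1 := by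
  have h' : (t + 1) % (r + 1) = 0 := by
    rw [Nat.succ_mod_succ_eq_zero_iff, h]
  unfold cyclicPath
  rw [h', h]
  simp

lemma count_mod_eq {n a : ℕ} (ha : a < n) (m : ℕ) :
    Nat.count (fun t => t % n = a) (n * m) = m := by
  have h := Nat.count_modEq_card (n * m) (show 0 < n by omega) a
  simpa [Nat.ModEq, Nat.mod_eq_of_lt ha, Nat.mul_div_cancel_left m (by omega : 0 < n)] using h

/-- The number of indices in `{1, …, i}` outside `S`. -/
noncomputable def countNotMem (S : Finset ℕ) (i : ℕ) : ℕ :=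
  Nat.count (fun k => k + 1 ∉ S) i

lemma countNotMem_of_mem {S : Finset ℕ} {i : ℕ} (hi : 1 ≤ i) (h : i ∈ S) :
    countNotMem S i = countNotMem S (i - 1) := by
  obtain ⟨i, rfl⟩ := Nat.exists_eq_add_of_le' hi
  simp [countNotMem, Nat.count_succ, h]

lemma countNotMem_of_notMem {S : Finset ℕ} {i : ℕ} (hi : 1 ≤ i) (h : i ∉ S) :
    countNotMem S i = countNotMem S (i - 1) + 1 := by
  obtain ⟨i, rfl⟩ := Nat.exists_eq_add_of_le' hi
  simp [countNotMem, Nat.count_succ, h]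

lemma card_filter_Icc_eq_count (S : Finset ℕ) (P : ℕ → Prop) [DecidablePred P] (n : ℕ) :
    ((Finset.Icc 1 n).filter (fun i => i ∉ S ∧ P (countNotMem S (i - 1)))).card =
      Nat.count P (countNotMem S n) := by
  induction n with
  | zero => simp [countNotMem]
  | succ n ih =>
    rw [← Finset.insert_Icc_right_eq_Icc_add_one (by omega), Finset.filter_insert]
    by_cases h : n + 1 ∈ S
    · rw [countNotMem_of_mem (by omega) h]
      simpa [h] using ih
    · rw [countNotMem_of_notMem (by omega) h, Nat.add_sub_cancel, Nat.count_succ, ← ih]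
      by_cases hP : P (countNotMem S n) <;> simp [h, hP]

lemma countNotMem_add_card {S : Finset ℕ} {n : ℕ} (hS : S ⊆ Finset.Icc 1 n) :
    countNotMem S n + S.card = n := by
  have h := card_filter_Icc_eq_count S (fun _ => True) n
  have h' := Finset.card_sdiff_add_card_eq_card hS
  rw [← Finset.filter_notMem_eq_sdiff] at h'
  simp only [and_true, Nat.count_true] at h
  rw [h] at h'
  simpa using h'

section Steps

variable {r : ℕ} {p : ℕ → Fin r → ℤ} {i : ℕ}

lemma not_lingerStep_of_eStep {j : Fin r} (h : eStep r p i j) : ¬ lingerStep r p i := by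
  intro h'
  have := h j
  have := h' j
  simp_all

lemma not_lingerStep_of_negStep (hr : 1 ≤ r) (h : negStep r p i) : ¬ lingerStep r p i := by
  intro h'
  have := h ⟨0, hr⟩
  have := h' ⟨0, hr⟩
  omega

lemma not_negStep_of_eStep {j : Fin r} (h : eStep r p i j) : ¬ negStep r p i := by
  intro h'
  have h1 := h j
  have h2 := h' j
  rw [if_pos rfl] at h1
  omega

lemma eStep_unique {j k : Fin r} (h : eStep r p i j) (h' : eStep r p i k) : j = k := by
  have h1 := h j
  have h2 := h' j
  by_contra hjk
  rw [if_pos rfl] at h1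
  rw [if_neg hjk] at h2
  omega

end Steps

/-- The periodic path that pauses exactly at the steps in `S`. -/
noncomputable def pausedPath (r : ℕ) (S : Finset ℕ) (i : ℕ) : Fin r → ℤ :=
  cyclicPath r (countNotMem S i)

section PausedPath

variable {r : ℕ} {S : Finset ℕ} {i : ℕ}

lemma lingerStep_pausedPath (hi : 1 ≤ i) (h : i ∈ S) : lingerStep r (pausedPath r S) i := by
  intro k
  rw [pausedPath, pausedPath, countNotMem_of_mem hi h]

lemma eStep_pausedPath (hi : 1 ≤ i) (h : i ∉ S) (j : Fin r)
    (hj : countNotMem S (i - 1) % (r + 1) = j) : eStep r (pausedPath r S) i j := by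
  intro k
  rw [pausedPath, pausedPath, countNotMem_of_notMem hi h,
    cyclicPath_succ_of_lt (by rw [hj]; exact j.isLt), hj]
  simp only [Fin.ext_iff]

lemma negStep_pausedPath (hi : 1 ≤ i) (h : i ∉ S)
    (hr : countNotMem S (i - 1) % (r + 1) = r) : negStep r (pausedPath r S) i := by
  intro k
  rw [pausedPath, pausedPath, countNotMem_of_notMem hi h, cyclicPath_succ_of_eq hr]

lemma pausedPath_step_cases (hi : 1 ≤ i) :
    (i ∈ S ∧ lingerStep r (pausedPath r S) i) ∨
    (∃ j : Fin r, i ∉ S ∧ countNotMem S (i - 1) % (r + 1) = j ∧ eStep r (pausedPath r S) i j) ∨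
    (i ∉ S ∧ countNotMem S (i - 1) % (r + 1) = r ∧ negStep r (pausedPath r S) i) := by
  by_cases h : i ∈ S
  · exact .inl ⟨h, lingerStep_pausedPath hi h⟩
  · rcases Nat.lt_or_ge (countNotMem S (i - 1) % (r + 1)) r with hlt | hge
    · exact .inr (.inl ⟨⟨_, hlt⟩, h, rfl, eStep_pausedPath hi h _ rfl⟩)
    · have heq := le_antisymm (Nat.lt_succ_iff.mp (Nat.mod_lt _ r.succ_pos)) hge
      exact .inr (.inr ⟨h, heq, negStep_pausedPath hi h heq⟩)

lemma lingerStep_pausedPath_iff (hr : 1 ≤ r) (hi : 1 ≤ i) :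
    lingerStep r (pausedPath r S) i ↔ i ∈ S := by
  refine ⟨fun hl => ?_, lingerStep_pausedPath hi⟩
  rcases pausedPath_step_cases (r := r) (S := S) hi with ⟨h, _⟩ | ⟨j, _, _, he⟩ | ⟨_, _, hn⟩
  · exact h
  · exact absurd hl (not_lingerStep_of_eStep he)
  · exact absurd hl (not_lingerStep_of_negStep hr hn)

lemma eStep_pausedPath_iff (hi : 1 ≤ i) (j : Fin r) :
    eStep r (pausedPath r S) i j ↔ i ∉ S ∧ countNotMem S (i - 1) % (r + 1) = j := by
  refine ⟨fun he => ?_, fun ⟨h, hj⟩ => eStep_pausedPath hi h j hj⟩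
  rcases pausedPath_step_cases (r := r) (S := S) hi with ⟨_, hl⟩ | ⟨k, h, hk, hek⟩ | ⟨_, _, hn⟩
  · exact absurd hl (not_lingerStep_of_eStep he)
  · rw [eStep_unique he hek]
    exact ⟨h, hk⟩
  · exact absurd hn (not_negStep_of_eStep he)

lemma negStep_pausedPath_iff (hr : 1 ≤ r) (hi : 1 ≤ i) :
    negStep r (pausedPath r S) i ↔ i ∉ S ∧ countNotMem S (i - 1) % (r + 1) = r := by
  refine ⟨fun hn => ?_, fun ⟨h, h'⟩ => negStep_pausedPath hi h h'⟩
  rcases pausedPath_step_cases (r := r) (S := S) hi with ⟨_, hl⟩ | ⟨j, _, _, he⟩ | ⟨h, h', _⟩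
  · exact absurd hl (not_lingerStep_of_negStep hr hn)
  · exact absurd hn (not_negStep_of_eStep he)
  · exact ⟨h, h'⟩

end PausedPath

/-- Realizability of any prescribed set of `ρ` lingering steps: if `g = (r+1)m + ρ`, then for
every subset `S ⊆ {1, …, g}` of size `ρ` there is a lingering lattice path `p 0, …, p g` in
`ℤ^r` with `p 0 = p g = (r, r−1, …, 1)`, every point in the open Weyl chamber, whose set of
lingering steps is exactly `S`, and which has exactly `m` steps in each coordinate direction
and exactly `m` steps equal to `(−1, …, −1)`. -/
theorem realizability_of_lingering_steps
    (r m ρ : ℕ) (hr : 1 ≤ r) (g : ℕ) (hg : g = (r + 1) * m + ρ)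
    (S : Finset ℕ) (hS : S ⊆ Finset.Icc 1 g) (hScard : S.card = ρ) :
    ∃ p : ℕ → Fin r → ℤ, IsLLP r g p ∧
      (∀ j : Fin r, p 0 j = (r : ℤ) - (j : ℤ)) ∧
      (∀ j : Fin r, p g j = (r : ℤ) - (j : ℤ)) ∧
      (∀ i ≤ g, inC r (p i)) ∧
      (∀ i ∈ Finset.Icc 1 g, (lingerStep r p i ↔ i ∈ S)) ∧
      (∀ j : Fin r, ((Finset.Icc 1 g).filter (fun i => eStep r p i j)).card = m) ∧
      ((Finset.Icc 1 g).filter (fun i => negStep r p i)).card = m := by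
  have hcount : countNotMem S g = (r + 1) * m := by
    have := countNotMem_add_card hS
    omega
  have hcard : ∀ a < r + 1, ((Finset.Icc 1 g).filter
      (fun i => i ∉ S ∧ countNotMem S (i - 1) % (r + 1) = a)).card = m := by
    intro a ha
    rw [card_filter_Icc_eq_count S (fun t => t % (r + 1) = a), hcount, count_mod_eq ha]
  refine ⟨pausedPath r S, fun i hi => ?_, fun j => ?_, fun j => ?_,
    fun i _ => inC_cyclicPath r _, fun i hi => ?_, fun j => ?_, ?_⟩
  · rcases pausedPath_step_cases (r := r) (S := S) (Finset.mem_Icc.mp hi).1 with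
      ⟨_, hl⟩ | ⟨j, _, _, he⟩ | ⟨_, _, hn⟩
    · exact .inr (.inr hl)
    · exact .inr (.inl ⟨j, he⟩)
    · exact .inl hn
  · simp [pausedPath, countNotMem, cyclicPath]
  · rw [pausedPath, hcount, cyclicPath_mul]
  · exact lingerStep_pausedPath_iff hr (Finset.mem_Icc.mp hi).1
  · rw [← hcard j (by omega)]
    exact congrArg Finset.card
      (Finset.filter_congr fun i hi => eStep_pausedPath_iff (Finset.mem_Icc.mp hi).1 j)
  · rw [← hcard r (by omega)]
    exact congrArg Finset.card
      (Finset.filter_congr fun i hi => negStep_pausedPath_iff hr (Finset.mem_Icc.mp hi).1)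
end

section
/- Let r ≥ 1 and m ≥ 1 be integers and set g = (r+1)m. Let P be the set of lattice paths p_0, p_1, …, p_g in ℤ^r with p_0 = p_g = (r, r−1, …, 1), with every step p_i − p_{i−1} belonging to {e_0, …, e_{r−1}, (−1,−1,…,−1)} (no lingering steps), and with every p_i in the open Weyl chamber C. Let T be the set of standard Young tableaux on the rectangle with m rows and r+1 columns (columns indexed 0, …, r): bijective fillings of the m×(r+1) rectangle with the numbers 1, …, g whose entries increase strictly along each row and along each column. Then the map which sends a path to the filling in which, for each 1 ≤ i ≤ g, the entry i is placed in column j if the i-th step is e_j (0 ≤ j ≤ r−1) and in column r if the i-th step is (−1,…,−1), in the lowest unoccupied row of that column, is a well-defined bijection from P onto T. -/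
open scoped Classical

/-- Extend a finite path `p : Fin (g+1) → Fin r → ℤ` to a function on `ℕ` (constant after `g`). -/
def ext (g r : ℕ) (p : Fin (g + 1) → Fin r → ℤ) : ℕ → Fin r → ℤ :=
  fun i => p ⟨min i g, by omega⟩

/-- A lattice path `p 0, …, p g` with `p 0 = p g = (r, r−1, …, 1)`, every step a standard
basis vector or `(−1, …, −1)` (no lingering steps), and every point in the open Weyl
chamber. -/
def IsGoodPath (r g : ℕ) (p : ℕ → Fin r → ℤ) : Prop :=
  (∀ j : Fin r, p 0 j = (r : ℤ) - (j : ℤ)) ∧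
  (∀ j : Fin r, p g j = (r : ℤ) - (j : ℤ)) ∧
  (∀ i ∈ Finset.Icc 1 g, negStep r p i ∨ ∃ j, eStep r p i j) ∧
  (∀ i ≤ g, inC r (p i))

/-- The `i`-th step of `p` is of "column type" `c`: the basis vector `e c` if `c < r`, and
`(−1, …, −1)` if `c = r`. -/
def hasTypeCol (r : ℕ) (p : ℕ → Fin r → ℤ) (i : ℕ) (c : Fin (r + 1)) : Prop :=
  if h : (c : ℕ) < r then eStep r p i ⟨c, h⟩ else negStep r p i

/-- `F : Fin m → Fin (r+1) → ℕ` is a standard Young tableau on the `m × (r+1)` rectangle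
filled with `1, …, g`: an injective filling with entries in `{1, …, g}` strictly increasing
along each row and each column. -/
def IsSYT (m r g : ℕ) (F : Fin m → Fin (r + 1) → ℕ) : Prop :=
  (∀ a c, F a c ∈ Finset.Icc 1 g) ∧
  (Function.Injective fun ac : Fin m × Fin (r + 1) => F ac.1 ac.2) ∧
  (∀ a : Fin m, ∀ c c' : Fin (r + 1), c < c' → F a c < F a c') ∧
  (∀ a a' : Fin m, a < a' → ∀ c : Fin (r + 1), F a c < F a' c)

/-- The filling associated to a path: the cell in row `a` and column `c` receives the
`(a+1)`-th smallest index `i ∈ {1, …, g}` whose step is of column type `c`; this realizes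
"entry `i` is placed in column `c` in the lowest unoccupied row". -/
noncomputable def fillMap (r g m : ℕ) (p : ℕ → Fin r → ℤ) :
    Fin m → Fin (r + 1) → ℕ :=
  fun a c => (((Finset.Icc 1 g).filter (fun i => hasTypeCol r p i c)).sort (· ≤ ·)).getD a 0

/-- The number of elements of `S` that are at most `i`. -/
def countLE (S : Finset ℕ) (i : ℕ) : ℕ := (S.filter (· ≤ i)).card

/-- The `k`-th coordinate of the step vector attached to column `c`. -/
def stepVec (r : ℕ) (c : Fin (r + 1)) (k : Fin r) : ℤ :=
  (if k.castSucc = c then 1 else 0) - if c = Fin.last r then 1 else 0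

/-- The indices of the steps of `p` of column type `c`. -/
noncomputable def colSet (r g : ℕ) (p : ℕ → Fin r → ℤ) (c : Fin (r + 1)) : Finset ℕ :=
  (Finset.Icc 1 g).filter (fun i => hasTypeCol r p i c)

/-- The lattice path whose steps of column type `c` are indexed by `S c`. -/
def pathOf (r : ℕ) (S : Fin (r + 1) → Finset ℕ) (i : ℕ) (k : Fin r) : ℤ :=
  (r : ℤ) - (k : ℤ) + countLE (S k.castSucc) i - countLE (S (Fin.last r)) i

lemma countLE_eq_pred_add (S : Finset ℕ) {i : ℕ} (hi : 1 ≤ i) :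
    countLE S i = countLE S (i - 1) + if i ∈ S then 1 else 0 := by
  unfold countLE
  have hlt : ∀ x, x ≤ i ↔ x = i ∨ x ≤ i - 1 := by intro x; omega
  simp only [hlt, Finset.filter_or]
  rw [Finset.card_union_of_disjoint, Finset.filter_eq']
  · split_ifs <;> simp [add_comm]
  · rw [Finset.disjoint_filter]
    intro x _ h
    omega

lemma countLE_zero {S : Finset ℕ} {g : ℕ} (hS : S ⊆ Finset.Icc 1 g) : countLE S 0 = 0 := by
  unfold countLE
  rw [Finset.card_eq_zero, Finset.filter_eq_empty_iff]
  intro x hx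
  have := Finset.mem_Icc.1 (hS hx)
  omega

lemma countLE_of_subset {S : Finset ℕ} {g : ℕ} (hS : S ⊆ Finset.Icc 1 g) :
    countLE S g = S.card := by
  unfold countLE
  rw [Finset.filter_true_of_mem]
  intro x hx
  exact (Finset.mem_Icc.1 (hS hx)).2

/-- Counting the elements of `S` that are at most `i` through an enumeration of `S`. -/
lemma countLE_image {m : ℕ} {f : Fin m → ℕ} (hf : Function.Injective f) (i : ℕ) :
    countLE (Finset.univ.image f) i = (Finset.univ.filter (fun a => f a ≤ i)).card := by
  unfold countLE
  rw [Finset.filter_image, Finset.card_image_of_injective _ hf]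

lemma succ_le_card_filter_le_iff {m : ℕ} {f : Fin m → ℕ} (hf : StrictMono f) (a : Fin m)
    (i : ℕ) : (a : ℕ) + 1 ≤ (Finset.univ.filter (fun b => f b ≤ i)).card ↔ f a ≤ i := by
  constructor
  · intro h
    by_contra hlt
    have hsub : Finset.univ.filter (fun b => f b ≤ i) ⊆ Finset.Iio a := by
      intro b hb
      rw [Finset.mem_filter] at hb
      rw [Finset.mem_Iio, ← hf.lt_iff_lt]
      omega
    have := Finset.card_le_card hsub
    rw [Fin.card_Iio] at this
    omega
  · intro h
    rw [← Fin.card_Iic]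
    refine Finset.card_le_card fun b hb => ?_
    rw [Finset.mem_Iic] at hb
    exact Finset.mem_filter.2 ⟨Finset.mem_univ _, (hf.monotone hb).trans h⟩

lemma hasTypeCol_iff (r : ℕ) (p : ℕ → Fin r → ℤ) (i : ℕ) (c : Fin (r + 1)) :
    hasTypeCol r p i c ↔ ∀ k, p i k = p (i - 1) k + stepVec r c k := by
  unfold hasTypeCol stepVec
  split_ifs with h h' h'
  · simp [h'] at h
  · have : ∀ k : Fin r, k.castSucc = c ↔ k = ⟨c, h⟩ := by
      intro k; simp [Fin.ext_iff]
    simp [eStep, this]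
  · have : ∀ k : Fin r, k.castSucc ≠ Fin.last r := fun k => (Fin.castSucc_lt_last k).ne
    simp [negStep, h', this, sub_eq_add_neg]
  · exact absurd (Fin.ext (by simp; omega)) h'

lemma stepVec_injective {r : ℕ} : Function.Injective (stepVec r) := by
  have hlast : ∀ k : Fin r, k.castSucc ≠ Fin.last r := fun k => (Fin.castSucc_lt_last k).ne
  intro c c' h
  induction c using Fin.lastCases with
  | last =>
    induction c' using Fin.lastCases with
    | last => rfl
    | cast j =>
      have := congrFun h j
      simp [stepVec, hlast] at this
  | cast j =>
    have := congrFun h j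
    by_contra hne
    simp only [stepVec, hlast, if_true, if_false, if_neg hne] at this
    split_ifs at this <;> omega

lemma hasTypeCol_unique {r : ℕ} {p : ℕ → Fin r → ℤ} {i : ℕ} {c c' : Fin (r + 1)}
    (h : hasTypeCol r p i c) (h' : hasTypeCol r p i c') : c = c' := by
  rw [hasTypeCol_iff] at h h'
  refine stepVec_injective (funext fun k => ?_)
  have := h k
  have := h' k
  omega

lemma exists_hasTypeCol_iff (r : ℕ) (p : ℕ → Fin r → ℤ) (i : ℕ) :
    (negStep r p i ∨ ∃ j, eStep r p i j) ↔ ∃ c, hasTypeCol r p i c := by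
  constructor
  · rintro (h | ⟨j, h⟩)
    · exact ⟨Fin.last r, by simpa [hasTypeCol] using h⟩
    · exact ⟨j.castSucc, by simpa [hasTypeCol] using h⟩
  · rintro ⟨c, h⟩
    unfold hasTypeCol at h
    split_ifs at h with hc
    · exact Or.inr ⟨_, h⟩
    · exact Or.inl h

/-- Membership in the open Weyl chamber, in terms of the numbers of steps of each type. -/
lemma inC_iff_antitone (r : ℕ) (N : Fin (r + 1) → ℕ) :
    inC r (fun k => (r : ℤ) - (k : ℤ) + N k.castSucc - N (Fin.last r)) ↔ Antitone N := by
  constructor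
  · rintro ⟨hlt, hpos⟩
    rw [Fin.antitone_iff_succ_le]
    intro i
    by_cases hi : (i : ℕ) + 1 < r
    · have := hlt i ⟨i + 1, hi⟩ (by simp [Fin.lt_def])
      have hs : (⟨i + 1, hi⟩ : Fin r).castSucc = i.succ := by ext; simp
      simp only [hs] at this
      push_cast at this
      omega
    · have := hpos i
      have hs : i.succ = Fin.last r := by ext; simp; omega
      have := i.2
      rw [hs]
      simp only at *
      omega
  · intro hN
    refine ⟨fun j k hjk => ?_, fun k => ?_⟩
    · have := hN (Fin.castSucc_le_castSucc_iff.2 hjk.le)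
      have : (j : ℕ) < k := hjk
      simp only at *
      omega
    · have := hN (Fin.le_last k.castSucc)
      have := k.2
      simp only
      omega

section Partition

variable {r g : ℕ} {p : ℕ → Fin r → ℤ} {S : Fin (r + 1) → Finset ℕ}

/-- If `S` partitions the step indices, the `i`-th step of `pathOf r S` is read off from `S`. -/
lemma pathOf_step (hdisj : ∀ i c c', i ∈ S c → i ∈ S c' → c = c') {i : ℕ} (hi : 1 ≤ i)
    {c : Fin (r + 1)} (hc : i ∈ S c) (k : Fin r) :
    pathOf r S i k = pathOf r S (i - 1) k + stepVec r c k := by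
  have hmem : ∀ c', i ∈ S c' ↔ c' = c :=
    fun c' => ⟨fun h => hdisj i c' c h hc, fun h => h ▸ hc⟩
  unfold pathOf stepVec
  rw [countLE_eq_pred_add _ hi, countLE_eq_pred_add (S (Fin.last r)) hi]
  simp only [hmem, eq_comm (a := c)]
  push_cast
  ring

lemma eq_pathOf (hS : ∀ c, S c ⊆ Finset.Icc 1 g)
    (hdisj : ∀ i c c', i ∈ S c → i ∈ S c' → c = c')
    (hcover : ∀ i ∈ Finset.Icc 1 g, ∃ c, i ∈ S c)
    (h0 : ∀ j : Fin r, p 0 j = (r : ℤ) - (j : ℤ))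
    (htype : ∀ c, ∀ i ∈ S c, hasTypeCol r p i c) :
    ∀ i ≤ g, p i = pathOf r S i := by
  intro i
  induction i with
  | zero =>
    intro _
    funext k
    simp [pathOf, countLE_zero (hS _), h0]
  | succ i ih =>
    intro hi
    obtain ⟨c, hc⟩ := hcover (i + 1) (Finset.mem_Icc.2 ⟨by omega, hi⟩)
    funext k
    rw [(hasTypeCol_iff r p _ c).1 (htype c _ hc) k, pathOf_step hdisj (by omega) hc,
      Nat.add_sub_cancel, ih (by omega)]

end Partition

lemma colSet_subset (r g : ℕ) (p : ℕ → Fin r → ℤ) (c : Fin (r + 1)) :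
    colSet r g p c ⊆ Finset.Icc 1 g :=
  Finset.filter_subset _ _

lemma colSet_disjoint (r g : ℕ) (p : ℕ → Fin r → ℤ) :
    ∀ i c c', i ∈ colSet r g p c → i ∈ colSet r g p c' → c = c' := fun _ _ _ h h' =>
  hasTypeCol_unique (Finset.mem_filter.1 h).2 (Finset.mem_filter.1 h').2

lemma fillMap_eq_orderEmbOfFin {r g m : ℕ} {p : ℕ → Fin r → ℤ} {c : Fin (r + 1)}
    (h : (colSet r g p c).card = m) (a : Fin m) :
    fillMap r g m p a c = (colSet r g p c).orderEmbOfFin h a := by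
  unfold fillMap
  rw [Finset.orderEmbOfFin_apply, List.getD_eq_getElem]
  rfl

section GoodPath

variable {r g m : ℕ} {p : ℕ → Fin r → ℤ}

lemma IsGoodPath.colSet_cover (hp : IsGoodPath r g p) :
    ∀ i ∈ Finset.Icc 1 g, ∃ c, i ∈ colSet r g p c := by
  intro i hi
  obtain ⟨c, hc⟩ := (exists_hasTypeCol_iff r p i).1 (hp.2.2.1 i hi)
  exact ⟨c, Finset.mem_filter.2 ⟨hi, hc⟩⟩

lemma IsGoodPath.eq_pathOf_colSet (hp : IsGoodPath r g p) :
    ∀ i ≤ g, p i = pathOf r (colSet r g p) i :=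
  eq_pathOf (colSet_subset r g p) (colSet_disjoint r g p) hp.colSet_cover hp.1
    fun _ _ hi => (Finset.mem_filter.1 hi).2

lemma IsGoodPath.card_colSet (hp : IsGoodPath r g p) (hg : g = (r + 1) * m)
    (c : Fin (r + 1)) : (colSet r g p c).card = m := by
  have heq : ∀ c, (colSet r g p c).card = (colSet r g p (Fin.last r)).card := by
    intro c
    induction c using Fin.lastCases with
    | last => rfl
    | cast j =>
      have h := congrFun (hp.eq_pathOf_colSet g le_rfl) j
      rw [hp.2.1 j] at h
      simp only [pathOf, countLE_of_subset (colSet_subset r g p _)] at h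
      omega
  have hunion : Finset.univ.biUnion (colSet r g p) = Finset.Icc 1 g := by
    ext i
    simp only [Finset.mem_biUnion, Finset.mem_univ, true_and]
    exact ⟨fun ⟨c, hc⟩ => colSet_subset r g p c hc, hp.colSet_cover i⟩
  have hcard := congrArg Finset.card hunion
  rw [Finset.card_biUnion, Finset.sum_congr rfl fun c _ => heq c] at hcard
  · simp only [Finset.sum_const, Finset.card_univ, Fintype.card_fin, smul_eq_mul, Nat.card_Icc,
      Nat.add_sub_cancel] at hcard
    rw [heq c]
    exact Nat.eq_of_mul_eq_mul_left (Nat.succ_pos r) (hcard.trans hg)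
  · intro c _ c' _ hne
    exact Finset.disjoint_left.2 fun i h h' => hne (colSet_disjoint r g p i c c' h h')

lemma IsGoodPath.image_fillMap (hp : IsGoodPath r g p) (hg : g = (r + 1) * m)
    (c : Fin (r + 1)) :
    Finset.univ.image (fun a => fillMap r g m p a c) = colSet r g p c := by
  simp only [fillMap_eq_orderEmbOfFin (hp.card_colSet hg c)]
  exact Finset.image_orderEmbOfFin_univ _ _

lemma IsGoodPath.strictMono_fillMap (hp : IsGoodPath r g p)
    (hg : g = (r + 1) * m) (c : Fin (r + 1)) : StrictMono fun a => fillMap r g m p a c := by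
  simp only [fillMap_eq_orderEmbOfFin (hp.card_colSet hg c)]
  exact OrderEmbedding.strictMono _

lemma IsGoodPath.isSYT_fillMap (hp : IsGoodPath r g p) (hg : g = (r + 1) * m) :
    IsSYT m r g (fillMap r g m p) := by
  have hmem : ∀ a c, fillMap r g m p a c ∈ colSet r g p c := fun a c => by
    rw [← hp.image_fillMap hg c]
    exact Finset.mem_image_of_mem _ (Finset.mem_univ a)
  have hmono := hp.strictMono_fillMap hg
  refine ⟨fun a c => colSet_subset r g p c (hmem a c), ?_, ?_, fun a a' h c => hmono c h⟩
  · rintro ⟨a, c⟩ ⟨a', c'⟩ h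
    simp only at h
    obtain rfl : c = c' := colSet_disjoint r g p _ c c' (hmem a c) (h ▸ hmem a' c')
    rw [(hmono c).injective h]
  · intro a c c' hcc
    have hg' := (Finset.mem_Icc.1 (colSet_subset r g p c' (hmem a c'))).2
    have hanti : Antitone fun c => countLE (colSet r g p c) (fillMap r g m p a c') := by
      rw [← inC_iff_antitone]
      have := hp.2.2.2 _ hg'
      rwa [hp.eq_pathOf_colSet _ hg'] at this
    have hle := hanti hcc.le
    simp only [← hp.image_fillMap hg, countLE_image (hmono _).injective] at hle
    have hle' := ((succ_le_card_filter_le_iff (hmono c') a _).2 le_rfl).trans hle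
    refine lt_of_le_of_ne ((succ_le_card_filter_le_iff (hmono c) a _).1 hle') fun h => ?_
    exact hcc.ne (colSet_disjoint r g p _ c c' (hmem a c) (h ▸ hmem a c'))

end GoodPath

section Tableau

variable {r g m : ℕ} {F : Fin m → Fin (r + 1) → ℕ}

/-- The set of entries of the tableau `F` in column `c`. -/
def columnEntries (F : Fin m → Fin (r + 1) → ℕ) (c : Fin (r + 1)) : Finset ℕ :=
  Finset.univ.image fun a => F a c

lemma IsSYT.strictMono_column (hF : IsSYT m r g F) (c : Fin (r + 1)) :
    StrictMono fun a => F a c :=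
  fun a a' h => hF.2.2.2 a a' h c

lemma IsSYT.columnEntries_subset (hF : IsSYT m r g F) (c : Fin (r + 1)) :
    columnEntries F c ⊆ Finset.Icc 1 g := by
  intro i hi
  obtain ⟨a, -, rfl⟩ := Finset.mem_image.1 hi
  exact hF.1 a c

lemma IsSYT.columnEntries_disjoint (hF : IsSYT m r g F) :
    ∀ i c c', i ∈ columnEntries F c → i ∈ columnEntries F c' → c = c' := by
  intro i c c' h h'
  obtain ⟨a, -, rfl⟩ := Finset.mem_image.1 h
  obtain ⟨a', -, h'⟩ := Finset.mem_image.1 h'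
  exact (congrArg Prod.snd (hF.2.1 (a₁ := (a', c')) (a₂ := (a, c)) h')).symm

lemma IsSYT.columnEntries_cover (hF : IsSYT m r g F) (hg : g = (r + 1) * m) :
    ∀ i ∈ Finset.Icc 1 g, ∃ c, i ∈ columnEntries F c := by
  have himage : Finset.univ.image (fun ac : Fin m × Fin (r + 1) => F ac.1 ac.2)
      = Finset.Icc 1 g := by
    refine Finset.eq_of_subset_of_card_le (fun i hi => ?_) ?_
    · obtain ⟨ac, -, rfl⟩ := Finset.mem_image.1 hi
      exact hF.1 _ _
    · rw [Finset.card_image_of_injective _ hF.2.1]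
      simp [hg, mul_comm]
  intro i hi
  rw [← himage] at hi
  obtain ⟨ac, -, rfl⟩ := Finset.mem_image.1 hi
  exact ⟨ac.2, Finset.mem_image_of_mem (fun a => F a ac.2) (Finset.mem_univ ac.1)⟩

lemma IsSYT.card_columnEntries (hF : IsSYT m r g F) (c : Fin (r + 1)) :
    (columnEntries F c).card = m := by
  unfold columnEntries
  rw [Finset.card_image_of_injective _ (hF.strictMono_column c).injective]
  simp

lemma IsSYT.antitone_countLE (hF : IsSYT m r g F) (i : ℕ) :
    Antitone fun c => countLE (columnEntries F c) i := by
  intro c c' h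
  simp only [columnEntries, countLE_image (hF.strictMono_column _).injective]
  refine Finset.card_le_card fun a ha => ?_
  rw [Finset.mem_filter] at ha ⊢
  refine ⟨ha.1, le_trans ?_ ha.2⟩
  rcases h.eq_or_lt with rfl | h
  · exact le_rfl
  · exact (hF.2.2.1 a c c' h).le

variable {p : ℕ → Fin r → ℤ}

lemma IsSYT.hasTypeCol_of_mem (hF : IsSYT m r g F)
    (hp : ∀ i ≤ g, p i = pathOf r (columnEntries F) i) (c : Fin (r + 1)) :
    ∀ i ∈ columnEntries F c, hasTypeCol r p i c := by
  intro i hi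
  have := Finset.mem_Icc.1 (hF.columnEntries_subset c hi)
  rw [hasTypeCol_iff, hp i this.2, hp (i - 1) (by omega)]
  exact pathOf_step hF.columnEntries_disjoint this.1 hi

lemma IsSYT.isGoodPath (hF : IsSYT m r g F) (hg : g = (r + 1) * m)
    (hp : ∀ i ≤ g, p i = pathOf r (columnEntries F) i) : IsGoodPath r g p := by
  refine ⟨fun j => ?_, fun j => ?_, fun i hi => ?_, fun i hi => ?_⟩
  · simp [hp 0 (Nat.zero_le g), pathOf, countLE_zero (hF.columnEntries_subset _)]
  · simp [hp g le_rfl, pathOf, countLE_of_subset (hF.columnEntries_subset _),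
      hF.card_columnEntries]
  · rw [exists_hasTypeCol_iff]
    obtain ⟨c, hc⟩ := hF.columnEntries_cover hg i hi
    exact ⟨c, hF.hasTypeCol_of_mem hp c i hc⟩
  · rw [hp i hi]
    exact (inC_iff_antitone r _).2 (hF.antitone_countLE i)

lemma IsSYT.colSet_eq (hF : IsSYT m r g F) (hg : g = (r + 1) * m)
    (hp : ∀ i ≤ g, p i = pathOf r (columnEntries F) i) (c : Fin (r + 1)) :
    colSet r g p c = columnEntries F c := by
  ext i
  refine ⟨fun hi => ?_, fun hi =>
    Finset.mem_filter.2 ⟨hF.columnEntries_subset c hi, hF.hasTypeCol_of_mem hp c i hi⟩⟩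
  obtain ⟨hi, hc⟩ := Finset.mem_filter.1 hi
  obtain ⟨c', hc'⟩ := hF.columnEntries_cover hg i hi
  rwa [hasTypeCol_unique hc (hF.hasTypeCol_of_mem hp c' i hc')]

lemma IsSYT.fillMap_eq (hF : IsSYT m r g F) (hg : g = (r + 1) * m)
    (hp : ∀ i ≤ g, p i = pathOf r (columnEntries F) i) : fillMap r g m p = F := by
  funext a c
  have hcol := hF.colSet_eq hg hp c
  have hcard : (colSet r g p c).card = m := hcol ▸ hF.card_columnEntries c
  rw [fillMap_eq_orderEmbOfFin hcard]
  refine (congrFun (Finset.orderEmbOfFin_unique hcard (f := fun a => F a c) (fun a => ?_)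
    (hF.strictMono_column c)) a).symm
  rw [hcol]
  exact Finset.mem_image_of_mem _ (Finset.mem_univ a)

end Tableau

lemma ext_apply_of_le {g r i : ℕ} (p : Fin (g + 1) → Fin r → ℤ) (hi : i ≤ g) :
    ext g r p i = p ⟨i, Nat.lt_succ_of_le hi⟩ := by
  simp [ext, hi]

/-- The map sending a lattice path from `(r, …, 1)` to itself in the open Weyl chamber, with
steps in `{e_0, …, e_{r−1}, (−1,…,−1)}`, to the filling in which entry `i` is placed in the
column given by the type of the `i`-th step, in the lowest unoccupied row of that column, is
a well-defined bijection onto the set of standard Young tableaux on the `m × (r+1)`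
rectangle. -/
theorem paths_biject_with_tableaux
    (r m : ℕ) (hr : 1 ≤ r) (hm : 1 ≤ m) (g : ℕ) (hg : g = (r + 1) * m) :
    Set.BijOn (fun p : Fin (g + 1) → Fin r → ℤ => fillMap r g m (ext g r p))
      {p | IsGoodPath r g (ext g r p)}
      {F | IsSYT m r g F} := by
  refine ⟨fun p hp => IsGoodPath.isSYT_fillMap hp hg, fun p hp q hq hpq => ?_, fun F hF => ?_⟩
  · rw [Set.mem_ofPred_eq] at hp hq
    have hcol : colSet r g (ext g r p) = colSet r g (ext g r q) := by
      funext c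
      rw [← hp.image_fillMap hg c, ← hq.image_fillMap hg c]
      simp only at hpq
      rw [hpq]
    funext i
    have hi : (i : ℕ) ≤ g := Nat.le_of_lt_succ i.2
    have h := hp.eq_pathOf_colSet i hi
    rw [hcol, ← hq.eq_pathOf_colSet i hi] at h
    simpa only [ext_apply_of_le _ hi] using h
  · rw [Set.mem_ofPred_eq] at hF
    have hp : ∀ i ≤ g, ext g r (fun i => pathOf r (columnEntries F) i) i
        = pathOf r (columnEntries F) i := fun i hi => ext_apply_of_le _ hi
    exact ⟨_, hF.isGoodPath hg hp, hF.fillMap_eq hg hp⟩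
end

section
/- Let g ≥ 2, r ≥ 1 and d ≥ 0 be integers with g − (r+1)(g−d+r) < 0. Then the chain-of-loops graph G_g has no divisor of degree d whose Baker–Norine rank is equal to r. (This confirms Baker's Brill–Noether nonexistence conjecture for graphs: G_g is a graph of genus g with no divisor of degree d and rank r when the Brill–Noether number ρ = g − (r+1)(g−d+r) is negative.) -/
open scoped Classical

/-- Vertices of the chain-of-loops graph `G_g`: the distinguished vertices `v_0, …, v_g`
(the left summand) together with, for each loop `i` (for `1 ≤ i+1 ≤ g`), the `2g−3` internal
vertices of the long path of the `(i+1)`-st loop (the right summand). -/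
abbrev ChainV (g : ℕ) := Fin (g + 1) ⊕ (Fin g × Fin (2 * g - 3))

/-- Generating relation for the edges of `G_g`: for each `i : Fin g`, the `(i+1)`-st loop
consists of a direct edge `v_i — v_{i+1}` together with a path
`v_i — (i,0) — (i,1) — ⋯ — (i, 2g−4) — v_{i+1}` of `2g−2` edges, so each loop is a cycle of
length `2g−1` (realizing edge lengths `ℓ_i = 2g−2`, `m_i = 1`, which are generic). -/
def chainRel (g : ℕ) : ChainV g → ChainV g → Prop
  | Sum.inl a, Sum.inl b => (b : ℕ) = (a : ℕ) + 1
  | Sum.inl a, Sum.inr (i, t) => (i : ℕ) = (a : ℕ) ∧ (t : ℕ) = 0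
  | Sum.inr (i, t), Sum.inl b => (b : ℕ) = (i : ℕ) + 1 ∧ (t : ℕ) = 2 * g - 4
  | Sum.inr (i, t), Sum.inr (i', t') => i = i' ∧ (t' : ℕ) = (t : ℕ) + 1

/-- The chain-of-loops graph `G_g`. -/
def chainGraph (g : ℕ) : SimpleGraph (ChainV g) := SimpleGraph.fromRel (chainRel g)

/-- The graph Laplacian of `G_g` applied to an integer-valued function on the vertices. -/
noncomputable def lap (g : ℕ) (f : ChainV g → ℤ) (v : ChainV g) : ℤ :=
  ∑ w : ChainV g, if (chainGraph g).Adj v w then f v - f w else 0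

/-- A divisor is effective if all its coefficients are nonnegative. -/
def Eff (g : ℕ) (D : ChainV g → ℤ) : Prop := ∀ v, 0 ≤ D v

/-- Two divisors are linearly equivalent if their difference is in the image of the graph
Laplacian. -/
def LinEq (g : ℕ) (D D' : ChainV g → ℤ) : Prop :=
  ∃ f : ChainV g → ℤ, ∀ v, D v - D' v = lap g f v

/-- The Baker–Norine rank of `D` is at least `n`: for every effective divisor `E` of degree
`n`, the divisor `D − E` is linearly equivalent to an effective divisor. -/
def RankGe (g : ℕ) (D : ChainV g → ℤ) (n : ℕ) : Prop :=
  ∀ E : ChainV g → ℤ, Eff g E → (∑ v, E v) = (n : ℤ) →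
    ∃ D' : ChainV g → ℤ, Eff g D' ∧ LinEq g (fun v => D v - E v) D'

/-- Every edge of the chain of loops is generated in exactly one of its two directions. -/
lemma ite_chainGraph_adj {A : Type*} [AddCommGroup A] (g : ℕ) (v w : ChainV g) (a : A) :
    (if (chainGraph g).Adj v w then a else 0) =
      (if chainRel g v w then a else 0) + (if chainRel g w v then a else 0) := by
  have key : v = w ∨ chainRel g w v → ¬ chainRel g v w := by
    rcases v with k | ⟨l, t⟩ <;> rcases w with k' | ⟨l', t'⟩ <;>
      intro h h' <;>
      simp only [chainRel, Sum.inl.injEq, Sum.inr.injEq, Prod.mk.injEq, Fin.ext_iff, reduceCtorEq,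
        false_or] at h h' <;> omega
  have key' : v = w → ¬ chainRel g w v := by
    rintro rfl
    exact key (Or.inl rfl)
  simp only [chainGraph, SimpleGraph.fromRel_adj]
  by_cases h₁ : v = w <;> by_cases h₂ : chainRel g v w <;> by_cases h₃ : chainRel g w v <;>
    simp_all

/-- Summation by parts for the Laplacian, in terms of oriented edges. -/
lemma sum_lap_mul {A : Type*} [CommRing A] (g : ℕ) (f : ChainV g → ℤ) (h : ChainV g → A) :
    ∑ v, (lap g f v : A) * h v =
      ∑ v, ∑ w, if chainRel g v w then ((f v : A) - f w) * (h v - h w) else 0 := by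
  have expand (v : ChainV g) : (lap g f v : A) * h v =
      ∑ w, (if chainRel g v w then ((f v : A) - f w) * h v else 0) +
      ∑ w, (if chainRel g w v then ((f v : A) - f w) * h v else 0) := by
    rw [← Finset.sum_add_distrib, lap, Int.cast_sum, Finset.sum_mul]
    refine Finset.sum_congr rfl fun w _ => ?_
    rw [← ite_chainGraph_adj]
    split_ifs <;> simp
  simp_rw [expand]
  rw [Finset.sum_add_distrib, Finset.sum_comm (f := fun v w =>
    if chainRel g w v then ((f v : A) - f w) * h v else 0), ← Finset.sum_add_distrib]
  refine Finset.sum_congr rfl fun v _ => ?_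
  rw [← Finset.sum_add_distrib]
  refine Finset.sum_congr rfl fun w _ => ?_
  split_ifs
  · ring
  · simp

lemma sum_lap (g : ℕ) (f : ChainV g → ℤ) : ∑ v, lap g f v = 0 := by
  simpa using sum_lap_mul g f (fun _ => (1 : ℤ))

/-- The position on loop `i` of the retraction of a vertex to that loop, as an element of
`ℤ / (2g - 1)`: the left end of the loop has position `0` and its right end position `1`. -/
def loopPos (g : ℕ) (i : Fin g) : ChainV g → ZMod (2 * g - 1)
  | Sum.inl k => if i.castSucc < k then 1 else 0
  | Sum.inr (l, t) => if l < i then 0 else if i < l then 1 else -((t : ℕ) + 1)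

/-- The vertices strictly to the left of `v_i`. -/
def LeftOf (g : ℕ) (i : Fin (g + 1)) : ChainV g → Prop
  | Sum.inl k => k < i
  | Sum.inr (l, _) => l.castSucc < i

/-- The degree of the part of a divisor strictly to the left of `v_i`. -/
noncomputable def leftDeg (g : ℕ) (i : Fin (g + 1)) (F : ChainV g → ℤ) : ℤ :=
  ∑ v, if LeftOf g i v then F v else 0

/-- Telescoping along a path. -/
lemma Fin.sum_sum_ite_sub {A : Type*} [AddCommGroup A] {m : ℕ} (G : Fin m → A) {z e : Fin m}
    (hz : (z : ℕ) = 0) (he : (e : ℕ) + 1 = m) :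
    ∑ t : Fin m, ∑ t' : Fin m, (if (t' : ℕ) = (t : ℕ) + 1 then G t - G t' else 0) =
      G z - G e := by
  obtain ⟨k, rfl⟩ : ∃ k, m = k + 1 := ⟨e, he.symm⟩
  obtain rfl : z = 0 := Fin.ext hz
  obtain rfl : e = Fin.last k := Fin.ext (by simpa using he)
  rw [Fin.sum_univ_castSucc]
  have hlast : ∑ t' : Fin (k + 1),
      (if (t' : ℕ) = (Fin.last k : ℕ) + 1 then G (Fin.last k) - G t' else 0)
      = 0 := Finset.sum_eq_zero fun t' _ => if_neg (by have := t'.2; simp; omega)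
  have hstep (t : Fin k) : ∑ t' : Fin (k + 1), (if (t' : ℕ) = (t.castSucc : ℕ) + 1 then
      G t.castSucc - G t' else 0) = G t.castSucc - G t.succ := by
    rw [Finset.sum_eq_single t.succ]
    · simp
    · intro b _ hb
      exact if_neg (by simpa [Fin.ext_iff] using hb)
    · simp
  rw [hlast, Finset.sum_congr rfl fun t _ => hstep t, Finset.sum_sub_distrib]
  have h₁ := Fin.sum_univ_castSucc G
  have h₂ := Fin.sum_univ_succ G
  rw [add_zero, sub_eq_sub_iff_add_eq_add, ← h₁, h₂, add_comm]

/-- `loopPos` is harmonic, so it defines an invariant of linear equivalence. -/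
lemma sum_lap_mul_loopPos (g : ℕ) (hg : 2 ≤ g) (i : Fin g) (f : ChainV g → ℤ) :
    ∑ v, (lap g f v : ZMod (2 * g - 1)) * loopPos g i v = 0 := by
  rw [sum_lap_mul]
  have hn : ((2 * g - 4 : ℕ) : ZMod (2 * g - 1)) = -3 := by
    have h : ((2 * g - 4 + 3 : ℕ) : ZMod (2 * g - 1)) = 0 := by
      rw [show 2 * g - 4 + 3 = 2 * g - 1 by omega]
      exact ZMod.natCast_self _
    push_cast at h
    linear_combination h
  obtain ⟨z, hz⟩ : ∃ z : Fin (2 * g - 3), (z : ℕ) = 0 := ⟨⟨0, by omega⟩, rfl⟩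
  obtain ⟨e, he⟩ : ∃ e : Fin (2 * g - 3), (e : ℕ) = 2 * g - 4 := ⟨⟨2 * g - 4, by omega⟩, rfl⟩
  set c : ChainV g → ZMod (2 * g - 1) := fun v => (f v : ZMod (2 * g - 1))
  rw [Fintype.sum_sum_type]
  simp_rw [Fintype.sum_sum_type, Finset.sum_add_distrib]
  have direct : ∑ a : Fin (g + 1), ∑ b : Fin (g + 1),
      (if chainRel g (Sum.inl a) (Sum.inl b) then
        (c (Sum.inl a) - c (Sum.inl b)) * (loopPos g i (Sum.inl a) - loopPos g i (Sum.inl b))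
        else 0) = -(c (Sum.inl i.castSucc) - c (Sum.inl i.succ)) := by
    rw [Finset.sum_eq_single i.castSucc, Finset.sum_eq_single i.succ]
    · simp [chainRel, loopPos]
    · intro b _ hb
      have : (b : ℕ) ≠ i + 1 := by simpa [Fin.ext_iff] using hb
      simp [chainRel, this]
    · simp
    · intro a _ ha
      have ha' : (a : ℕ) ≠ i := by simpa [Fin.ext_iff] using ha
      refine Finset.sum_eq_zero fun b _ => ?_
      split_ifs with h
      · simp only [chainRel] at h
        have : (i.castSucc < a ↔ i.castSucc < b) := by
          simp only [Fin.lt_def, Fin.val_castSucc]; omega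
        simp [loopPos, this]
      · rfl
    · simp
  have first : ∑ a : Fin (g + 1), ∑ p : Fin g × Fin (2 * g - 3),
      (if chainRel g (Sum.inl a) (Sum.inr p) then
        (c (Sum.inl a) - c (Sum.inr p)) * (loopPos g i (Sum.inl a) - loopPos g i (Sum.inr p))
        else 0) = c (Sum.inl i.castSucc) - c (Sum.inr (i, z)) := by
    rw [Finset.sum_eq_single i.castSucc, Finset.sum_eq_single (i, z)]
    · simp [chainRel, loopPos, hz]
    · rintro ⟨l, t⟩ _ hb
      have : ¬ ((l : ℕ) = i ∧ (t : ℕ) = 0) := by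
        simpa [Fin.ext_iff, hz] using hb
      simp [chainRel, this]
    · simp
    · intro a _ ha
      have ha' : (a : ℕ) ≠ i := by simpa [Fin.ext_iff] using ha
      refine Finset.sum_eq_zero ?_
      rintro ⟨l, t⟩ _
      split_ifs with h
      · simp only [chainRel] at h
        rcases lt_or_gt_of_ne ha' with h' | h'
        · have h₁ : ¬ i.castSucc < a := by simp only [Fin.lt_def, Fin.val_castSucc]; omega
          have h₂ : l < i := by simp only [Fin.lt_def]; omega
          simp [loopPos, h₁, h₂]
        · have h₁ : i.castSucc < a := by simp only [Fin.lt_def, Fin.val_castSucc]; omega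
          have h₂ : i < l := by simp only [Fin.lt_def]; omega
          simp [loopPos, h₁, h₂, h₂.not_gt]
      · rfl
    · simp
  have last : ∑ p : Fin g × Fin (2 * g - 3), ∑ b : Fin (g + 1),
      (if chainRel g (Sum.inr p) (Sum.inl b) then
        (c (Sum.inr p) - c (Sum.inl b)) * (loopPos g i (Sum.inr p) - loopPos g i (Sum.inl b))
        else 0) = c (Sum.inr (i, e)) - c (Sum.inl i.succ) := by
    rw [Finset.sum_comm, Finset.sum_eq_single i.succ, Finset.sum_eq_single (i, e)]
    · simp only [chainRel, loopPos, he, hn, Fin.val_succ, and_self, if_true, lt_irrefl, if_false,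
        Fin.castSucc_lt_succ]
      ring
    · rintro ⟨l, t⟩ _ hb
      have : ¬ ((i : ℕ) = l ∧ (t : ℕ) = 2 * g - 4) := by
        simpa [Fin.ext_iff, he, eq_comm] using hb
      simp [chainRel, this]
    · simp
    · intro b _ hb
      have hb' : (b : ℕ) ≠ i + 1 := by simpa [Fin.ext_iff] using hb
      refine Finset.sum_eq_zero ?_
      rintro ⟨l, t⟩ _
      split_ifs with h
      · simp only [chainRel] at h
        rcases lt_or_gt_of_ne hb' with h' | h'
        · have h₁ : ¬ i.castSucc < b := by simp only [Fin.lt_def, Fin.val_castSucc]; omega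
          have h₂ : l < i := by simp only [Fin.lt_def]; omega
          simp [loopPos, h₁, h₂]
        · have h₁ : i.castSucc < b := by simp only [Fin.lt_def, Fin.val_castSucc]; omega
          have h₂ : i < l := by simp only [Fin.lt_def]; omega
          simp [loopPos, h₁, h₂, h₂.not_gt]
      · rfl
    · simp
  have inner : ∑ p : Fin g × Fin (2 * g - 3), ∑ q : Fin g × Fin (2 * g - 3),
      (if chainRel g (Sum.inr p) (Sum.inr q) then
        (c (Sum.inr p) - c (Sum.inr q)) * (loopPos g i (Sum.inr p) - loopPos g i (Sum.inr q))
        else 0) = c (Sum.inr (i, z)) - c (Sum.inr (i, e)) := by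
    rw [← Fin.sum_sum_ite_sub (fun t => c (Sum.inr (i, t))) hz (by omega : (e : ℕ) + 1 = 2 * g - 3)]
    simp_rw [Fintype.sum_prod_type]
    rw [Finset.sum_eq_single i]
    · refine Finset.sum_congr rfl fun t _ => ?_
      rw [Finset.sum_eq_single i]
      · refine Finset.sum_congr rfl fun t' _ => ?_
        simp only [chainRel, loopPos, true_and, lt_irrefl, if_false]
        split_ifs with h
        · rw [h]; push_cast; ring
        · rfl
      · intro l _ hl
        exact Finset.sum_eq_zero fun t' _ => if_neg fun h => hl h.1.symm
      · simp
    · intro l _ hl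
      refine Finset.sum_eq_zero fun t _ => Finset.sum_eq_zero fun l' _ =>
        Finset.sum_eq_zero fun t' _ => ?_
      split_ifs with h
      · obtain rfl : l = l' := h.1
        rcases lt_or_gt_of_ne hl with h' | h'
        · simp [loopPos, h']
        · simp [loopPos, h', h'.not_gt]
      · rfl
    · simp
  rw [direct, first, last, inner]
  ring

/-- Passing loop `i` from left to right. -/
lemma leftDeg_succ (g : ℕ) (i : Fin g) (F : ChainV g → ℤ) :
    leftDeg g i.succ F = leftDeg g i.castSucc F + F (Sum.inl i.castSucc) +
      ∑ v, if ∃ t, v = Sum.inr (i, t) then F v else 0 := by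
  have : F (Sum.inl i.castSucc) = ∑ v, if v = Sum.inl i.castSucc then F v else 0 := by simp
  rw [leftDeg, leftDeg, this, ← Finset.sum_add_distrib, ← Finset.sum_add_distrib]
  refine Finset.sum_congr rfl ?_
  rintro (k | ⟨l, t⟩) _
  · rcases lt_trichotomy k i.castSucc with h | rfl | h
    · simp [LeftOf, h, h.ne, h.trans i.castSucc_lt_succ]
    · simp [LeftOf]
    · have : ¬ k < i.succ := by simpa [Fin.lt_def, Nat.lt_succ_iff] using h
      simp [LeftOf, this, h.ne', h.not_gt]
  · rcases lt_trichotomy l i with h | rfl | h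
    · have : l.castSucc < i.succ := by
        simp only [Fin.lt_def, Fin.val_castSucc, Fin.val_succ] at *; omega
      simp [LeftOf, h, h.ne, this]
    · simp [LeftOf]
    · have : ¬ l.castSucc < i.succ := by
        simp only [Fin.lt_def, Fin.val_castSucc, Fin.val_succ] at *; omega
      simp [LeftOf, this, h.ne', h.not_gt]

/-- `F` has the same degree and the same loop invariants as `D`. -/
def SameInvariants (g : ℕ) (D F : ChainV g → ℤ) : Prop :=
  ∑ v, F v = ∑ v, D v ∧ ∀ i, ∑ v, (F v : ZMod (2 * g - 1)) * loopPos g i v =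
    ∑ v, (D v : ZMod (2 * g - 1)) * loopPos g i v

lemma RankGe.exists_sameInvariants {g : ℕ} (hg : 2 ≤ g) {D : ChainV g → ℤ} {r : ℕ}
    (hD : RankGe g D r) {E : ChainV g → ℤ} (hE : Eff g E) (hr : ∑ v, E v = r) :
    ∃ F, E ≤ F ∧ SameInvariants g D F := by
  obtain ⟨D', hD', f, hf⟩ := hD E hE hr
  have hF (v : ChainV g) : D' v + E v = D v - lap g f v := by linarith [hf v]
  refine ⟨fun v => D' v + E v, fun v => by simpa using hD' v, ?_, fun i => ?_⟩
  · simp_rw [hF, Finset.sum_sub_distrib, sum_lap, sub_zero]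
  · simp_rw [hF, Int.cast_sub, sub_mul, Finset.sum_sub_distrib,
      sum_lap_mul_loopPos g hg, sub_zero]

/-- Prescribing `j` chips at `v_0, …, v_i` can force every divisor with the invariants of `D`
containing them to have at most `c` chips left at or beyond `v_i`, not counting the
prescribed ones. -/
def Forces (g : ℕ) (D : ChainV g → ℤ) (i : Fin (g + 1)) (j : ℕ) (c : ℤ) : Prop :=
  ∃ E : ChainV g → ℤ, Eff g E ∧ ∑ v, E v = j ∧ (∀ k, i < k → E (Sum.inl k) = 0) ∧
    ∀ F, E ≤ F → SameInvariants g D F → ∑ v, D v - c ≤ leftDeg g i F + E (Sum.inl i)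

namespace Forces

variable {g : ℕ} {D : ChainV g → ℤ}

lemma zero : Forces g D 0 0 (∑ v, D v) := by
  refine ⟨0, fun _ => le_rfl, by simp, fun _ _ => rfl, fun F hF _ => ?_⟩
  simp only [sub_self, Pi.zero_apply, add_zero]
  refine Finset.sum_nonneg fun v _ => ?_
  split_ifs
  · exact hF v
  · rfl

lemma take_many {i : Fin (g + 1)} {j : ℕ} {c : ℤ} (h : Forces g D i j c) (m : ℕ) :
    Forces g D i (j + m) (c - m) := by
  obtain ⟨E, hE, hj, hs, hF⟩ := h
  refine ⟨fun v => E v + if v = Sum.inl i then (m : ℤ) else 0, fun v => ?_, ?_, fun k hk => ?_,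
    fun F hEF hinv => ?_⟩
  · have := hE v
    dsimp only
    split_ifs <;> omega
  · rw [Finset.sum_add_distrib, hj]
    simp
  · simp [hs k hk, hk.ne']
  · have := hF F (fun v => le_trans (by dsimp only; split_ifs <;> omega) (hEF v)) hinv
    simp only [if_true]
    linarith

lemma keep {i : Fin g} {j : ℕ} {c : ℤ} (h : Forces g D i.castSucc j c) :
    Forces g D i.succ j c := by
  obtain ⟨E, hE, hj, hs, hF⟩ := h
  refine ⟨E, hE, hj, fun k hk => hs k (i.castSucc_lt_succ.trans hk), fun F hEF hinv => ?_⟩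
  rw [hs _ i.castSucc_lt_succ, leftDeg_succ]
  have h₁ := hF F hEF hinv
  have h₂ := hEF (Sum.inl i.castSucc)
  have h₃ : 0 ≤ ∑ v, if ∃ t, v = Sum.inr (i, t) then F v else 0 :=
    Finset.sum_nonneg fun v _ => by
      split_ifs
      · exact (hE v).trans (hEF v)
      · rfl
  linarith

lemma drop {i : Fin g} {j : ℕ} {c : ℤ} (h : Forces g D i.castSucc j c)
    (hc : (c : ZMod (2 * g - 1)) ≠ ∑ v, (D v : ZMod (2 * g - 1)) * loopPos g i v) :
    Forces g D i.succ j (c - 1) := by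
  obtain ⟨E, hE, hj, hs, hF⟩ := h
  refine ⟨E, hE, hj, fun k hk => hs k (i.castSucc_lt_succ.trans hk), fun F hEF hinv => ?_⟩
  rw [hs _ i.castSucc_lt_succ]
  have h₁ := hF F hEF hinv
  have h₂ := hEF (Sum.inl i.castSucc)
  have nonneg : ∀ v ∈ Finset.univ, 0 ≤ if ∃ t, v = Sum.inr (i, t) then F v else 0 :=
    fun v _ => by
      split_ifs
      · exact (hE v).trans (hEF v)
      · rfl
  have h₃ := Finset.sum_nonneg nonneg
  have h₄ := leftDeg_succ g i F
  by_contra! hlt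
  have hleft : leftDeg g i.succ F = ∑ v, D v - c := by linarith
  have hzero : ∑ v, (if ∃ t, v = Sum.inr (i, t) then F v else 0) = 0 := by linarith
  have hF0 (t) : F (Sum.inr (i, t)) = 0 := by
    simpa using (Finset.sum_eq_zero_iff_of_nonneg nonneg).1 hzero (Sum.inr (i, t))
  refine hc ?_
  have hright : c = ∑ v, if LeftOf g i.succ v then 0 else F v := by
    have : ∑ v, F v = leftDeg g i.succ F + ∑ v, if LeftOf g i.succ v then 0 else F v := by
      rw [leftDeg, ← Finset.sum_add_distrib]
      exact Finset.sum_congr rfl fun v _ => by split_ifs <;> simp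
    rw [hinv.1] at this
    linarith
  rw [← hinv.2 i, hright, Int.cast_sum]
  refine Finset.sum_congr rfl ?_
  rintro (k | ⟨l, t⟩) _
  · by_cases hk : i.castSucc < k
    · have : ¬ k < i.succ := by simpa [Fin.lt_def, Nat.lt_succ_iff] using hk
      simp [LeftOf, loopPos, hk, this]
    · have : k < i.succ := by simpa [Fin.lt_def, Nat.lt_succ_iff] using hk
      simp [LeftOf, loopPos, hk, this]
  · rcases lt_trichotomy l i with hl | rfl | hl
    · have : l.castSucc < i.succ := by
        simp only [Fin.lt_def, Fin.val_castSucc, Fin.val_succ] at *; omega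
      simp [LeftOf, loopPos, hl, this]
    · simp [hF0]
    · have : ¬ l.castSucc < i.succ := by
        simp only [Fin.lt_def, Fin.val_castSucc, Fin.val_succ] at *; omega
      simp [LeftOf, loopPos, hl, hl.not_gt, this]

lemma le_of_rankGe (hg : 2 ≤ g) {r : ℕ} (hD : RankGe g D r) {i : Fin (g + 1)} {j : ℕ} {c : ℤ}
    (h : Forces g D i j c) (hj : j ≤ r) : (r : ℤ) - j ≤ c := by
  obtain ⟨E, hE, hsum, -, hF⟩ := h.take_many (r - j)
  rw [Nat.add_sub_cancel' hj] at hsum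
  obtain ⟨F, hEF, hinv⟩ := hD.exists_sameInvariants hg hE hsum
  have h₁ := hF F hEF hinv
  have h₂ : leftDeg g i F + F (Sum.inl i) ≤ ∑ v, F v := by
    have : F (Sum.inl i) = ∑ v, if v = Sum.inl i then F v else 0 := by simp
    rw [leftDeg, this, ← Finset.sum_add_distrib]
    refine Finset.sum_le_sum fun v _ => ?_
    have hv := (hE v).trans (hEF v)
    by_cases hvi : v = Sum.inl i
    · subst hvi
      simp [LeftOf]
    · rw [if_neg hvi]
      split_ifs <;> omega
  rw [hinv.1] at h₂
  have h₃ := hEF (Sum.inl i)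
  push_cast [hj] at h₁
  linarith

end Forces

lemma intCast_sub_one_ne {g : ℕ} (hg : 2 ≤ g) {c : ℤ} {x : ZMod (2 * g - 1)}
    (h : (c : ZMod (2 * g - 1)) = x) : ((c - 1 : ℤ) : ZMod (2 * g - 1)) ≠ x := by
  have : Fact (1 < 2 * g - 1) := ⟨by omega⟩
  simp [← h]

/-- With enough prescribed chips one loses a chip on every loop. -/
lemma exists_forces_no_keep {g : ℕ} (hg : 2 ≤ g) (D : ChainV g → ℤ) (i : Fin (g + 1)) :
    ∃ j : ℕ, j ≤ i ∧ Forces g D i j (∑ v, D v - j - (i : ℕ)) := by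
  induction i using Fin.induction with
  | zero => exact ⟨0, by simp, by simpa using Forces.zero⟩
  | succ i ih =>
    obtain ⟨j, hj, h⟩ := ih
    simp only [Fin.val_castSucc, Fin.val_succ] at *
    by_cases hx : ((∑ v, D v - j - (i : ℕ) : ℤ) : ZMod (2 * g - 1)) =
        ∑ v, (D v : ZMod (2 * g - 1)) * loopPos g i v
    · refine ⟨j + 1, by omega, ?_⟩
      convert (h.take_many 1).drop (by simpa using intCast_sub_one_ne hg hx) using 1
      push_cast; ring
    · refine ⟨j, by omega, ?_⟩
      convert h.drop hx using 1
      push_cast; ring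

/-- The `r + 1` optimal strategies evolve as distinct particles, at most one of which
fails to move on each loop. -/
lemma exists_forces_particles {g : ℕ} (hg : 2 ≤ g) {D : ChainV g → ℤ} {r : ℕ}
    (hD : RankGe g D r) (hd : ∑ v, D v < 2 * g - 1) (i : Fin (g + 1)) :
    ∃ p : ℕ → ℤ, StrictAnti p ∧ p 0 ≤ ∑ v, D v ∧ (∀ j ≤ r, Forces g D i j (p j)) ∧
      ∑ j ∈ Finset.range (r + 1), (p j - ∑ v, D v + j + (i : ℕ)) ≤ (i : ℕ) := by
  induction i using Fin.induction with
  | zero =>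
    refine ⟨fun j => ∑ v, D v - j, fun a b hab => by dsimp only; omega, by simp, fun j _ => ?_,
      by simp⟩
    simpa using Forces.zero.take_many j
  | succ i ih =>
    obtain ⟨p, hp, hp0, hforce, hsum⟩ := ih
    simp only [Fin.val_castSucc, Fin.val_succ] at *
    set x := ∑ v, (D v : ZMod (2 * g - 1)) * loopPos g i v
    let stays (j : ℕ) : Prop := (p j : ZMod (2 * g - 1)) = x ∧ ∀ k, k + 1 = j → p k ≠ p j + 1
    refine ⟨fun j => if stays j then p j else p j - 1, strictAnti_nat_of_succ_lt fun j => ?_, ?_,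
      fun j hj => ?_, ?_⟩
    · have h := hp (show j < j + 1 by omega)
      by_cases hs : stays (j + 1)
      · have := hs.2 j rfl
        simp only [if_pos hs]
        split_ifs <;> omega
      · simp only [if_neg hs]
        split_ifs <;> omega
    · dsimp only
      split_ifs <;> omega
    · dsimp only
      split_ifs with hs
      · exact (hforce j hj).keep
      · by_cases hxj : (p j : ZMod (2 * g - 1)) = x
        · obtain ⟨k, rfl, hk⟩ : ∃ k, k + 1 = j ∧ p k = p j + 1 := by
            by_contra! hcon
            exact hs ⟨hxj, hcon⟩
          have hne : (p k : ZMod (2 * g - 1)) ≠ x := fun h =>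
            intCast_sub_one_ne hg h (by rw [hk, add_sub_cancel_right, hxj])
          convert ((hforce k (by omega)).drop hne).take_many 1 using 1
          push_cast; omega
        · exact (hforce j hj).drop hxj
    · have hone : ∑ j ∈ Finset.range (r + 1), (if stays j then (1 : ℤ) else 0) ≤ 1 := by
        rw [Finset.sum_boole]
        norm_cast
        refine Finset.card_le_one.2 fun a ha b hb => hp.injective ?_
        simp only [Finset.mem_filter, Finset.mem_range] at ha hb
        have hdvd : ((2 * g - 1 : ℕ) : ℤ) ∣ p a - p b :=
          (ZMod.intCast_eq_intCast_iff_dvd_sub _ _ _).1 (hb.2.1.trans ha.2.1.symm)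
        have ha' := (hforce a (by omega)).le_of_rankGe hg hD (by omega)
        have hb' := (hforce b (by omega)).le_of_rankGe hg hD (by omega)
        have ha0 := hp.antitone (Nat.zero_le a)
        have hb0 := hp.antitone (Nat.zero_le b)
        have := Int.eq_zero_of_abs_lt_dvd hdvd (by rw [abs_lt]; omega)
        omega
      have hstep : ∑ j ∈ Finset.range (r + 1),
          ((if stays j then p j else p j - 1) - ∑ v, D v + j + ((i : ℕ) + 1 : ℕ)) =
          ∑ j ∈ Finset.range (r + 1), (p j - ∑ v, D v + j + (i : ℕ)) +
            ∑ j ∈ Finset.range (r + 1), (if stays j then (1 : ℤ) else 0) := by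
        rw [← Finset.sum_add_distrib]
        refine Finset.sum_congr rfl fun j _ => ?_
        push_cast
        split_ifs <;> ring
      rw [hstep]
      push_cast
      linarith

/-- Baker's Brill–Noether nonexistence conjecture for graphs: if
`ρ = g − (r+1)(g−d+r) < 0`, then the chain-of-loops graph `G_g` has no divisor of degree `d`
whose Baker–Norine rank is equal to `r` (rank equal to `r ≥ 0` means: rank at least `r` but
not at least `r+1`). -/
theorem no_special_divisors_on_chain_of_loops
    (g : ℕ) (hg : 2 ≤ g) (r d : ℕ) (hr : 1 ≤ r)
    (hρ : (g : ℤ) - ((r : ℤ) + 1) * ((g : ℤ) - (d : ℤ) + (r : ℤ)) < 0) :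
    ¬ ∃ D : ChainV g → ℤ, (∑ v, D v) = (d : ℤ) ∧
        RankGe g D r ∧ ¬ RankGe g D (r + 1) := by
  rintro ⟨D, hdeg, hD, -⟩
  have hs : (0 : ℤ) < g - d + r := by
    by_contra! hs
    nlinarith [mul_nonneg (by positivity : (0 : ℤ) ≤ r + 1) (neg_nonneg.2 hs)]
  have hrg : r < g := by
    by_contra! hrg
    obtain ⟨j, hj, h⟩ := exists_forces_no_keep hg D (Fin.last g)
    rw [Fin.val_last] at hj h
    have := h.le_of_rankGe hg hD (by omega)
    omega
  obtain ⟨p, -, -, hforce, hsum⟩ := exists_forces_particles hg hD (by omega) (Fin.last g)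
  have hle : ∑ j ∈ Finset.range (r + 1), ((g : ℤ) - d + r) ≤
      ∑ j ∈ Finset.range (r + 1), (p j - ∑ v, D v + j + ((Fin.last g : Fin (g + 1)) : ℕ)) := by
    refine Finset.sum_le_sum fun j hj => ?_
    have hj' : j ≤ r := Nat.lt_succ_iff.1 (Finset.mem_range.1 hj)
    have := (hforce j hj').le_of_rankGe hg hD hj'
    rw [hdeg, Fin.val_last]
    linarith
  rw [Finset.sum_const, Finset.card_range, nsmul_eq_mul] at hle
  rw [Fin.val_last] at hsum hle
  push_cast at hle
  linarith
end
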